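/- For every positive natural number n there exists a constant C > 0, depending only on n, such that for every R > 0 there exists a smooth compactly supported radial function η : ℝⁿ → ℝ with: (i) the support of η is contained in the open ball of radius R centered at the origin; (ii) 0 ≤ η(x) ≤ 1 for all x; (iii) η(x) = 1 for all x with ‖x‖ ≤ R/2; (iv) ‖∇η(x)‖ ≤ (C/R) · η(x)^{1/2} for all x ∈ ℝⁿ; (v) Δη(x) ≥ -C/R² for all x ∈ ℝⁿ; and (vi) x · ∇η(x) ≤ 0 for all x ∈ ℝⁿ, so that for any continuously differentiable φ : ℝⁿ → ℝ whose gradient has the form ∇φ(x) = k(‖x‖)·x with k ≥ 0, one has ∇φ(x) · ∇η(x) ≤ 0 for all x. -/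

import Mathlib

open MeasureTheory Real
open scoped BigOperators RealInnerProductSpace

noncomputable section

/-- The Euclidean Laplacian `Δf(x) = Σᵢ ∂²f/∂xᵢ²(x)` of `f : ℝⁿ → ℝ`. -/
def lap {n : ℕ} (f : EuclideanSpace ℝ (Fin n) → ℝ) (x : EuclideanSpace ℝ (Fin n)) : ℝ :=
  ∑ i : Fin n,
    fderiv ℝ (fun y => fderiv ℝ f y (EuclideanSpace.single i 1)) x (EuclideanSpace.single i 1)

/-- The Laplacian of a dilated function: `Δ(f(c ·)) = c² (Δf)(c ·)`. -/
theorem lap_comp_smul {n : ℕ} (f : EuclideanSpace ℝ (Fin n) → ℝ) (c : ℝ)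
    (x : EuclideanSpace ℝ (Fin n)) :
    lap (fun y => f (c • y)) x = c ^ 2 * lap f (c • x) := by
  simp only [lap, Finset.mul_sum]
  refine Finset.sum_congr rfl fun i _ => ?_
  have h : (fun y => fderiv ℝ (fun z => f (c • z)) y (EuclideanSpace.single i 1)) =
      c • fun y => (fun z => fderiv ℝ f z (EuclideanSpace.single i 1)) (c • y) := by
    funext y
    simp [fderiv_comp_smul]
  rw [h, fderiv_const_smul_field, Pi.smul_apply,
    fderiv_comp_smul (f := fun z => fderiv ℝ f z (EuclideanSpace.single i 1))]
  simp only [smul_apply, smul_eq_mul]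
  ring

/-- The Laplacian of a compactly supported smooth function is bounded. -/
theorem exists_abs_lap_le {n : ℕ} {f : EuclideanSpace ℝ (Fin n) → ℝ}
    (hf : ContDiff ℝ (⊤ : ℕ∞) f) (hs : HasCompactSupport f) :
    ∃ L : ℝ, ∀ x, |lap f x| ≤ L := by
  have hbound (i : Fin n) : ∃ L : ℝ, ∀ x,
      ‖fderiv ℝ (fun y => fderiv ℝ f y (EuclideanSpace.single i 1)) x
        (EuclideanSpace.single i 1)‖ ≤ L := by
    have hd : ContDiff ℝ 1 fun y => fderiv ℝ f y (EuclideanSpace.single i 1) :=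
      ((hf.of_le (WithTop.coe_le_coe.2 le_top)).fderiv_right (m := 1) (n := 2)
        (by norm_num)).clm_apply contDiff_const
    exact ((hs.fderiv_apply ℝ _).fderiv_apply ℝ _).exists_bound_of_continuous
      ((hd.continuous_fderiv one_ne_zero).clm_apply continuous_const)
  choose L hL using hbound
  exact ⟨∑ i, L i, fun x => (Finset.abs_sum_le_sum_abs _ _).trans
    (Finset.sum_le_sum fun i _ => hL i x)⟩

section RadialBump

variable {E : Type*} [NormedAddCommGroup E]

/-- A smooth radial bump, equal to `1` for `‖x‖ ≤ 1 / 2` and to `0` for `3 / 4 ≤ ‖x‖`. -/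
def radialBump (x : E) : ℝ := smoothTransition (2 - 4 * ‖x‖ ^ 2)

theorem radialBump_nonneg (x : E) : 0 ≤ radialBump x := smoothTransition.nonneg _

theorem radialBump_le_one (x : E) : radialBump x ≤ 1 := smoothTransition.le_one _

theorem radialBump_eq_one {x : E} (hx : ‖x‖ ≤ 1 / 2) : radialBump x = 1 :=
  smoothTransition.one_of_one_le (by nlinarith [norm_nonneg x])

theorem radialBump_eq_zero {x : E} (hx : 3 / 4 ≤ ‖x‖) : radialBump x = 0 :=
  smoothTransition.zero_of_nonpos (by nlinarith)

theorem hasCompactSupport_radialBump [ProperSpace E] :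
    HasCompactSupport (radialBump : E → ℝ) :=
  HasCompactSupport.intro (isCompact_closedBall 0 (3 / 4)) fun x hx =>
    radialBump_eq_zero (by simpa using (not_le.1 (mt mem_closedBall_zero_iff.2 hx)).le)

variable [InnerProductSpace ℝ E]

theorem contDiff_radialBump : ContDiff ℝ (⊤ : ℕ∞) (radialBump : E → ℝ) :=
  smoothTransition.contDiff.comp
    (contDiff_const.sub (contDiff_const.mul (contDiff_norm_sq ℝ)))

/-- The bump does not increase in the radial direction. -/
theorem fderiv_radialBump_self_nonpos (x : E) : fderiv ℝ (radialBump : E → ℝ) x x ≤ 0 := by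
  have hT : HasDerivAt smoothTransition (deriv smoothTransition (2 - 4 * ‖x‖ ^ 2))
      (2 - 4 * ‖x‖ ^ 2) :=
    ((smoothTransition.contDiff (n := 1)).differentiable (by simp) _).hasDerivAt
  have hn : HasFDerivAt (fun y : E => 2 - 4 * ‖y‖ ^ 2) (-((4 : ℝ) • (2 • innerSL ℝ x))) x :=
    ((hasStrictFDerivAt_norm_sq x).hasFDerivAt.const_mul 4).const_sub 2
  have h : HasFDerivAt (radialBump : E → ℝ) _ x := hT.comp_hasFDerivAt x hn
  rw [h.fderiv]
  have h0 : 0 ≤ deriv smoothTransition (2 - 4 * ‖x‖ ^ 2) :=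
    smoothTransition.monotone.deriv_nonneg
  simp only [smul_apply, neg_apply, innerSL_apply_apply,
    real_inner_self_eq_norm_sq, smul_eq_mul, nsmul_eq_mul]
  push_cast
  nlinarith [mul_nonneg h0 (sq_nonneg ‖x‖)]

theorem fderiv_radialBump_sq (x : E) :
    fderiv ℝ (fun y : E => radialBump y ^ 2) x =
      (2 * radialBump x) • fderiv ℝ (radialBump : E → ℝ) x := by
  have h := (contDiff_radialBump (E := E)).differentiable (by simp) x
  simpa using (h.hasFDerivAt.pow 2).fderiv

end RadialBump

/-- the radial cut-off function lemma for the Witten Laplacian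
(paper's Lemma 7). As Lemma 5, but `η` is radial and additionally `x·∇η(x) ≤ 0`, so that
for any `C¹` potential `φ` with `∇φ(x) = k(‖x‖)·x`, `k ≥ 0`, one has `∇φ·∇η ≤ 0`. -/
theorem radial_cutoff_function_exists (n : ℕ) (hn : 0 < n) :
    ∃ C : ℝ, 0 < C ∧ ∀ R : ℝ, 0 < R →
      ∃ η : EuclideanSpace ℝ (Fin n) → ℝ,
        ContDiff ℝ (⊤ : ℕ∞) η ∧ HasCompactSupport η ∧
        (∃ ψ : ℝ → ℝ, ∀ x, η x = ψ ‖x‖) ∧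
        tsupport η ⊆ Metric.ball (0 : EuclideanSpace ℝ (Fin n)) R ∧
        (∀ x, 0 ≤ η x ∧ η x ≤ 1) ∧
        (∀ x, ‖x‖ ≤ R / 2 → η x = 1) ∧
        (∀ x, ‖gradient η x‖ ≤ C / R * Real.sqrt (η x)) ∧
        (∀ x, -(C / R ^ 2) ≤ lap η x) ∧
        (∀ x, ⟪x, gradient η x⟫ ≤ 0) ∧
        (∀ φ : EuclideanSpace ℝ (Fin n) → ℝ, ContDiff ℝ 1 φ →
          (∃ k : ℝ → ℝ, (∀ r, 0 ≤ k r) ∧ ∀ x, gradient φ x = k ‖x‖ • x) →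
          ∀ x, ⟪gradient φ x, gradient η x⟫ ≤ 0) := by
  have hη : ContDiff ℝ (⊤ : ℕ∞) fun y : EuclideanSpace ℝ (Fin n) => radialBump y ^ 2 :=
    contDiff_radialBump.pow 2
  obtain ⟨L, hL⟩ := exists_abs_lap_le hη
    (hasCompactSupport_radialBump.comp_left (g := fun t : ℝ => t ^ 2) (by simp))
  obtain ⟨M, hM⟩ := (hasCompactSupport_radialBump (E := EuclideanSpace ℝ (Fin n))).fderiv ℝ
    |>.exists_bound_of_continuous (contDiff_radialBump.continuous_fderiv (by simp))
  have hL0 : 0 ≤ L := (abs_nonneg _).trans (hL 0)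
  have hM0 : 0 ≤ M := (norm_nonneg _).trans (hM 0)
  refine ⟨L + 2 * M + 1, by positivity, fun R hR => ?_⟩
  have hnorm (x : EuclideanSpace ℝ (Fin n)) : ‖R⁻¹ • x‖ = ‖x‖ / R := by
    rw [norm_smul, norm_inv, Real.norm_of_nonneg hR.le, inv_mul_eq_div]
  have hfderiv (x : EuclideanSpace ℝ (Fin n)) :
      fderiv ℝ (fun y : EuclideanSpace ℝ (Fin n) => radialBump (R⁻¹ • y) ^ 2) x =
        (R⁻¹ * (2 * radialBump (R⁻¹ • x))) • fderiv ℝ radialBump (R⁻¹ • x) := by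
    rw [fderiv_comp_smul (f := fun y : EuclideanSpace ℝ (Fin n) => radialBump y ^ 2),
      fderiv_radialBump_sq, smul_smul]
  have hzero (x : EuclideanSpace ℝ (Fin n)) (hx : x ∉ Metric.closedBall 0 (3 / 4 * R)) :
      radialBump (R⁻¹ • x) ^ 2 = 0 := by
    rw [mem_closedBall_zero_iff, not_le] at hx
    rw [radialBump_eq_zero (by rw [hnorm, le_div_iff₀ hR]; exact hx.le), sq, zero_mul]
  have hradial (x : EuclideanSpace ℝ (Fin n)) :
      ⟪x, gradient (fun y => radialBump (R⁻¹ • y) ^ 2) x⟫ ≤ 0 := by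
    have hx : fderiv ℝ radialBump (R⁻¹ • x) x =
        R * fderiv ℝ radialBump (R⁻¹ • x) (R⁻¹ • x) := by
      rw [map_smul, smul_eq_mul, mul_inv_cancel_left₀ hR.ne']
    rw [inner_gradient_right, conj_trivial, hfderiv, smul_apply, smul_eq_mul,
      hx]
    have h0 := radialBump_nonneg (R⁻¹ • x)
    exact mul_nonpos_of_nonneg_of_nonpos (by positivity)
      (mul_nonpos_of_nonneg_of_nonpos hR.le (fderiv_radialBump_self_nonpos _))
  refine ⟨fun x => radialBump (R⁻¹ • x) ^ 2, hη.comp (contDiff_const_smul _),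
    HasCompactSupport.intro (isCompact_closedBall 0 (3 / 4 * R)) hzero,
    ⟨fun r => smoothTransition (2 - 4 * (r / R) ^ 2) ^ 2, fun x => by
      simp only [radialBump, hnorm]⟩,
    ?_, fun x => ⟨sq_nonneg _, pow_le_one₀ (radialBump_nonneg _) (radialBump_le_one _)⟩,
    fun x hx => ?_, fun x => ?_, fun x => ?_, hradial, ?_⟩
  · exact (closure_minimal (Function.support_subset_iff'.2 hzero) Metric.isClosed_closedBall).trans
      (Metric.closedBall_subset_ball (by linarith))
  · beta_reduce
    rw [radialBump_eq_one, one_pow]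
    rw [hnorm, div_le_iff₀ hR]
    linarith
  · have h0 := radialBump_nonneg (R⁻¹ • x)
    rw [gradient, LinearIsometryEquiv.norm_map, hfderiv, norm_smul, Real.sqrt_sq h0,
      Real.norm_of_nonneg (by positivity)]
    calc R⁻¹ * (2 * radialBump (R⁻¹ • x)) * ‖fderiv ℝ radialBump (R⁻¹ • x)‖
        ≤ R⁻¹ * (2 * radialBump (R⁻¹ • x)) * M := by gcongr; exact hM _
      _ = 2 * M / R * radialBump (R⁻¹ • x) := by ring
      _ ≤ (L + 2 * M + 1) / R * radialBump (R⁻¹ • x) := by gcongr; linarith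
  · rw [lap_comp_smul fun y : EuclideanSpace ℝ (Fin n) => radialBump y ^ 2]
    calc -((L + 2 * M + 1) / R ^ 2) = R⁻¹ ^ 2 * -(L + 2 * M + 1) := by
          rw [inv_pow]; ring
      _ ≤ _ := by
          gcongr
          linarith [(abs_le.1 (hL (R⁻¹ • x))).1]
  · rintro φ - ⟨k, hk, hφ⟩ x
    rw [hφ, real_inner_smul_left]
    exact mul_nonpos_of_nonneg_of_nonpos (hk _) (hradial x)
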